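/- As H → ∞, Σ_{h ≤ H} 𝔖(h)/h² = 7/4 + B/2 + 6 ∫_1^∞ f(u)/u⁴ du + O(1/H); in particular the full series satisfies Σ_{h=1}^∞ 𝔖(h)/h² = 7/4 + B/2 + 6 ∫_1^∞ f(u)/u⁴ du, where B = −C₀ − log 2π and C₀ is Euler's constant. -/

import Mathlib

open Real MeasureTheory

/-- The singular series of the twin prime / Goldbach type problems. -/
noncomputable def singularSeries (d : ℕ) : ℝ :=
  if Even d then
    2 * (∏' p : Nat.Primes, if 2 < (p : ℕ) then (1 - 1 / ((p : ℝ) - 1) ^ 2) else 1) *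
      ∏ p ∈ d.primeFactors.filter (fun p => 2 < p), ((p : ℝ) - 1) / ((p : ℝ) - 2)
  else 0

/-- The constant `B = -C₀ - log 2π`. -/
noncomputable def Bconst : ℝ := -Real.eulerMascheroniConstant - Real.log (2 * Real.pi)

/-- `ε(y) = Σ_{h ≤ y} 𝔖(h) - y + (1/2) log y`. -/
noncomputable def epsErr (y : ℝ) : ℝ :=
  (∑ h ∈ Finset.Icc 1 ⌊y⌋₊, singularSeries h) - y + Real.log y / 2

/-- `f(y) = ∫_1^y (ε(u) - B/2) du`. -/
noncomputable def fErr (y : ℝ) : ℝ := ∫ u in (1 : ℝ)..y, (epsErr u - Bconst / 2)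

/-- Bound on the averages of `∏_{p ∣ h} (1 + a p)` over `1 ≤ h ≤ N`. -/
theorem sum_prod_primeFactors_one_add_le (a : ℕ → ℝ) (ha : ∀ p, 0 ≤ a p) (q : ℕ → Prop)
    [DecidablePred q] (N : ℕ) :
    ∑ h ∈ Finset.Icc 1 N, ∏ p ∈ h.primeFactors.filter q, (1 + a p) ≤
      N * ∏ p ∈ (Finset.Icc 1 N).filter (fun p => p.Prime ∧ q p), (1 + a p / p) := by
  set P := (Finset.Icc 1 N).filter (fun p => p.Prime ∧ q p) with hP
  have expand : ∀ h ∈ Finset.Icc 1 N, ∏ p ∈ h.primeFactors.filter q, (1 + a p) =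
      ∑ T ∈ P.powerset, if T ⊆ h.primeFactors.filter q then ∏ p ∈ T, a p else 0 := by
    intro h hh
    rw [Finset.prod_one_add, ← Finset.sum_filter]
    refine Finset.sum_congr ?_ fun _ _ => rfl
    ext T
    simp only [Finset.mem_powerset, Finset.mem_filter]
    refine ⟨fun hT => ⟨fun p hp => ?_, hT⟩, fun hT => hT.2⟩
    obtain ⟨hp1, hp2⟩ := Finset.mem_filter.1 (hT hp)
    have hpp := Nat.prime_of_mem_primeFactors hp1
    have hle := Nat.le_of_mem_primeFactors hp1
    rw [Finset.mem_Icc] at hh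
    simp only [hP, Finset.mem_filter, Finset.mem_Icc]
    exact ⟨⟨hpp.one_le, hle.trans hh.2⟩, hpp, hp2⟩
  rw [Finset.sum_congr rfl expand, Finset.sum_comm, Finset.prod_one_add, Finset.mul_sum]
  refine Finset.sum_le_sum fun T hT => ?_
  have hTp : ∀ p ∈ T, p.Prime := fun p hp =>
    (Finset.mem_filter.1 (Finset.mem_powerset.1 hT hp)).2.1
  have hcard : (((Finset.Icc 1 N).filter (fun h => T ⊆ h.primeFactors.filter q)).card : ℝ) ≤
      N / ∏ p ∈ T, (p : ℝ) := by
    have hsub : (Finset.Icc 1 N).filter (fun h => T ⊆ h.primeFactors.filter q) ⊆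
        (Finset.Ioc 0 N).filter (fun h => (∏ p ∈ T, p) ∣ h) := by
      intro h hh
      simp only [Finset.mem_filter, Finset.mem_Icc, Finset.mem_Ioc] at hh ⊢
      refine ⟨by omega, Finset.prod_primes_dvd h (fun p hp => (hTp p hp).prime) fun p hp => ?_⟩
      exact Nat.dvd_of_mem_primeFactors (Finset.mem_filter.1 (hh.2 hp)).1
    have h1 := Finset.card_le_card hsub
    rw [Nat.Ioc_filter_dvd_card_eq_div] at h1
    calc _ ≤ ((N / ∏ p ∈ T, p : ℕ) : ℝ) := by exact_mod_cast h1
      _ ≤ _ := by simpa using (Nat.cast_div_le : ((N / ∏ p ∈ T, p : ℕ) : ℝ) ≤ _)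
  rw [← Finset.sum_filter, Finset.sum_const, nsmul_eq_mul, Finset.prod_div_distrib]
  calc _ ≤ (N / ∏ p ∈ T, (p : ℝ)) * ∏ p ∈ T, a p := by
        gcongr
        exact Finset.prod_nonneg fun p _ => ha p
    _ = _ := by ring

/-- The partial sums of `|𝔖|` grow at most linearly. -/
theorem exists_sum_abs_singularSeries_le :
    ∃ K : ℝ, 0 ≤ K ∧ ∀ N : ℕ, ∑ h ∈ Finset.Icc 1 N, |singularSeries h| ≤ K * N := by
  set c : ℝ :=
    2 * (∏' p : Nat.Primes, if 2 < (p : ℕ) then (1 - 1 / ((p : ℝ) - 1) ^ 2) else 1) with hc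
  set a : ℕ → ℝ := fun p => if 2 < p then 1 / ((p : ℝ) - 2) else 0 with ha
  have ha0 : ∀ p, 0 ≤ a p := by
    intro p
    simp only [ha]
    split_ifs with h
    · have : (2 : ℝ) < p := by exact_mod_cast h
      exact one_div_nonneg.2 (by linarith)
    · exact le_rfl
  have hsum : Summable fun n : ℕ => 3 * (1 / (n : ℝ) ^ 2) :=
    (Real.summable_one_div_nat_pow.2 one_lt_two).mul_left 3
  set M := Real.exp (∑' n : ℕ, 3 * (1 / (n : ℝ) ^ 2)) with hM
  have hprod (N : ℕ) :
      ∏ p ∈ (Finset.Icc 1 N).filter (fun p => p.Prime ∧ 2 < p), (1 + a p / p) ≤ M := by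
    calc _ ≤ ∏ p ∈ (Finset.Icc 1 N).filter (fun p => p.Prime ∧ 2 < p),
          Real.exp (3 * (1 / (p : ℝ) ^ 2)) := by
          refine Finset.prod_le_prod (fun p _ => ?_) fun p hp => ?_
          · have := ha0 p
            positivity
          · have hp2 : 2 < p := (Finset.mem_filter.1 hp).2.2
            have hp3 : (3 : ℝ) ≤ p := by exact_mod_cast hp2
            have : a p / p ≤ 3 * (1 / (p : ℝ) ^ 2) := by
              simp only [ha, if_pos hp2]
              rw [div_div, mul_one_div, div_le_div_iff₀ (by nlinarith) (by positivity)]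
              nlinarith
            calc 1 + a p / p ≤ 3 * (1 / (p : ℝ) ^ 2) + 1 := by linarith
              _ ≤ _ := Real.add_one_le_exp _
      _ = Real.exp (∑ p ∈ (Finset.Icc 1 N).filter (fun p => p.Prime ∧ 2 < p),
          3 * (1 / (p : ℝ) ^ 2)) := (Real.exp_sum _ _).symm
      _ ≤ M := Real.exp_le_exp.2 (hsum.sum_le_tsum _ fun p _ => by positivity)
  refine ⟨|c| * M, by positivity, fun N => ?_⟩
  have hterm (h : ℕ) : |singularSeries h| ≤
      |c| * ∏ p ∈ h.primeFactors.filter (fun p => 2 < p), (1 + a p) := by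
    have hnn : 0 ≤ ∏ p ∈ h.primeFactors.filter (fun p => 2 < p), (1 + a p) :=
      Finset.prod_nonneg fun p _ => by linarith [ha0 p]
    unfold singularSeries
    split_ifs
    · rw [← hc, abs_mul]
      refine mul_le_mul_of_nonneg_left (le_of_eq ?_) (abs_nonneg c)
      rw [← abs_of_nonneg hnn]
      congr 1
      refine Finset.prod_congr rfl fun p hp => ?_
      have hp2 : 2 < p := (Finset.mem_filter.1 hp).2
      have : (2 : ℝ) < p := by exact_mod_cast hp2
      have : (p : ℝ) - 2 ≠ 0 := by linarith
      simp only [ha, if_pos hp2]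
      field_simp
      ring
    · simpa using mul_nonneg (abs_nonneg c) hnn
  calc _ ≤ ∑ h ∈ Finset.Icc 1 N,
        |c| * ∏ p ∈ h.primeFactors.filter (fun p => 2 < p), (1 + a p) :=
        Finset.sum_le_sum fun h _ => hterm h
    _ ≤ |c| * (N * M) := by
        rw [← Finset.mul_sum]
        refine mul_le_mul_of_nonneg_left ?_ (abs_nonneg c)
        exact (sum_prod_primeFactors_one_add_le a ha0 _ N).trans
          (mul_le_mul_of_nonneg_left (hprod N) N.cast_nonneg)
    _ = _ := by ring

/-- Tail bound for `∑ a(h) / h²` when the partial sums of `a` grow at most linearly. -/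
theorem sum_Ioc_div_sq_le {a : ℕ → ℝ} {K : ℝ} (ha : ∀ n, 0 ≤ a n) (hK : 0 ≤ K)
    (hsum : ∀ N : ℕ, ∑ h ∈ Finset.Icc 1 N, a h ≤ K * N) {H M : ℕ} (hH : 1 ≤ H) (hM : H ≤ M) :
    ∑ h ∈ Finset.Ioc H M, a h / (h : ℝ) ^ 2 ≤ 2 * K / H := by
  set A : ℕ → ℝ := fun n => ∑ h ∈ Finset.Icc 1 n, a h
  have hA0 (n : ℕ) : 0 ≤ A n := Finset.sum_nonneg fun h _ => ha h
  have key : ∑ h ∈ Finset.Ioc H M, a h / (h : ℝ) ^ 2 ≤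
      A M / (M : ℝ) ^ 2 - 2 * K / M + 2 * K / H := by
    induction M, hM using Nat.le_induction with
    | base =>
      have := hA0 H
      simp only [Finset.Ioc_self, Finset.sum_empty, sub_add_cancel]
      positivity
    | succ M hM ih =>
      have hM0 : (0 : ℝ) < M := by exact_mod_cast hH.trans hM
      rw [← Finset.insert_Ioc_right_eq_Ioc_add_one hM, Finset.sum_insert (by simp)]
      have hA : A (M + 1) = A M + a (M + 1) := Finset.sum_Icc_succ_top (by omega) _
      have hstep : A M * (1 / (M : ℝ) ^ 2 - 1 / ((M : ℝ) + 1) ^ 2) ≤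
          2 * K / M - 2 * K / (M + 1) := by
        have h1 : (1 : ℝ) / (M : ℝ) ^ 2 - 1 / ((M : ℝ) + 1) ^ 2 =
            (2 * M + 1) / (M ^ 2 * (M + 1) ^ 2) := by field_simp; ring
        have h2 : 2 * K / M - 2 * K / (M + 1) = 2 * K / (M * (M + 1)) := by field_simp; ring
        rw [h1, h2]
        calc A M * ((2 * M + 1) / (M ^ 2 * (M + 1) ^ 2))
            ≤ (K * M) * ((2 * (M + 1)) / (M ^ 2 * (M + 1) ^ 2)) := by
              gcongr
              · exact hsum M
              · linarith
          _ = _ := by field_simp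
      have h3 : A M * (1 / (M : ℝ) ^ 2 - 1 / ((M : ℝ) + 1) ^ 2) =
          A M / (M : ℝ) ^ 2 - A M / ((M : ℝ) + 1) ^ 2 := by ring
      push_cast
      rw [hA, add_div]
      linarith
  have hM0 : (0 : ℝ) < M := by exact_mod_cast hH.trans hM
  have h1 : A M / (M : ℝ) ^ 2 ≤ K / M := by
    rw [div_le_div_iff₀ (by positivity) hM0]
    nlinarith [mul_le_mul_of_nonneg_right (hsum M) hM0.le]
  have h2 : K / M ≤ 2 * K / M := by gcongr; linarith
  linarith

/-- Abel summation for `∑_{1 ≤ k ≤ m} c(k) / k²`. -/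
theorem sum_Icc_one_div_sq_eq (c : ℕ → ℝ) (m : ℕ) :
    ∑ k ∈ Finset.Icc 1 m, c k / (k : ℝ) ^ 2 =
      (∑ k ∈ Finset.Icc 1 m, c k) / (m : ℝ) ^ 2 +
        2 * ∫ t in Set.Ioc (1 : ℝ) m, (∑ k ∈ Finset.Icc 1 ⌊t⌋₊, c k) / t ^ 3 := by
  have hIcc (g : ℕ → ℝ) (n : ℕ) :
      ∑ k ∈ Finset.Icc 0 n, g k * (if k = 0 then 0 else c k) = ∑ k ∈ Finset.Icc 1 n, g k * c k := by
    rw [← Finset.insert_Icc_add_one_left_eq_Icc n.zero_le, Finset.sum_insert (by simp)]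
    simp only [if_true, mul_zero, zero_add]
    refine Finset.sum_congr rfl fun k hk => ?_
    rw [if_neg (by have := (Finset.mem_Icc.1 hk).1; omega)]
  have hIcc' (n : ℕ) :
      ∑ k ∈ Finset.Icc 0 n, (if k = 0 then 0 else c k) = ∑ k ∈ Finset.Icc 1 n, c k := by
    simpa using hIcc (fun _ => 1) n
  have hd (t : ℝ) (ht : t ≠ 0) : HasDerivAt (fun t : ℝ => (t ^ 2)⁻¹) (-2 / t ^ 3) t := by
    convert! (hasDerivAt_pow 2 t).inv (pow_ne_zero 2 ht) using 1
    field_simp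
    norm_num
  have hne (t : ℝ) (ht : t ∈ Set.Icc (1 : ℝ) m) : t ≠ 0 := by linarith [ht.1]
  have hint : IntegrableOn (deriv fun t : ℝ => (t ^ 2)⁻¹) (Set.Icc (1 : ℝ) m) := by
    refine IntegrableOn.congr_fun (f := fun t : ℝ => -2 / t ^ 3) ?_
      (fun t ht => (hd t (hne t ht)).deriv.symm) measurableSet_Icc
    refine ContinuousOn.integrableOn_Icc fun t ht => ?_
    have := hne t ht
    exact ContinuousAt.continuousWithinAt (by fun_prop (disch := positivity))
  have h := sum_mul_eq_sub_integral_mul₀' (fun k => if k = 0 then 0 else c k) (by simp) m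
    (fun t ht => (hd t (hne t ht)).differentiableAt) hint
  simp only [hIcc', hIcc (fun k => (((k : ℝ)) ^ 2)⁻¹)] at h
  have hcongr : ∫ t in Set.Ioc (1 : ℝ) m,
      deriv (fun t : ℝ => (t ^ 2)⁻¹) t * ∑ k ∈ Finset.Icc 1 ⌊t⌋₊, c k =
      ∫ t in Set.Ioc (1 : ℝ) m, -2 * ((∑ k ∈ Finset.Icc 1 ⌊t⌋₊, c k) / t ^ 3) := by
    refine setIntegral_congr_fun measurableSet_Ioc fun t ht => ?_
    rw [(hd t (hne t ⟨ht.1.le, ht.2⟩)).deriv]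
    ring
  rw [hcongr, integral_const_mul] at h
  simp only [div_eq_inv_mul] at h ⊢
  rw [h]
  ring

theorem measurable_epsErr : Measurable epsErr := by
  have h : Measurable fun y : ℝ => ∑ h ∈ Finset.Icc 1 ⌊y⌋₊, singularSeries h :=
    (measurable_from_nat (f := fun n : ℕ => ∑ h ∈ Finset.Icc 1 n, singularSeries h)).comp
      Nat.measurable_floor
  unfold epsErr
  fun_prop

/-- `ε` is continuous from the right at every positive real. -/
theorem continuousWithinAt_epsErr {x : ℝ} (hx : 0 < x) :
    ContinuousWithinAt epsErr (Set.Ioi x) x := by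
  have h : ContinuousWithinAt (fun y : ℝ => ∑ h ∈ Finset.Icc 1 ⌊y⌋₊, singularSeries h)
      (Set.Ioi x) x := by
    refine continuousWithinAt_const.congr_of_eventuallyEq
      (f := fun _ => ∑ h ∈ Finset.Icc 1 ⌊x⌋₊, singularSeries h) ?_ rfl
    filter_upwards [self_mem_nhdsWithin,
      mem_nhdsWithin_of_mem_nhds (Iio_mem_nhds (Nat.lt_floor_add_one x))] with y hy hy'
    have hy0 : x < y := hy
    rw [Nat.floor_eq_on_Ico ⌊x⌋₊ y ⟨(Nat.floor_le hx.le).trans hy0.le, hy'⟩]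
  have hlog : ContinuousWithinAt Real.log (Set.Ioi x) x :=
    (Real.continuousAt_log hx.ne').continuousWithinAt
  unfold epsErr
  exact (h.sub continuousWithinAt_id).add (hlog.div_const 2)

theorem abs_epsErr_sub_le {K : ℝ} (hK0 : 0 ≤ K)
    (hK : ∀ N : ℕ, ∑ h ∈ Finset.Icc 1 N, |singularSeries h| ≤ K * N) (b : ℝ) {u : ℝ} (hu : 1 ≤ u) :
    |epsErr u - b| ≤ (K + 2 + |b|) * u := by
  have h1 : |∑ h ∈ Finset.Icc 1 ⌊u⌋₊, singularSeries h| ≤ K * u :=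
    (Finset.abs_sum_le_sum_abs _ _).trans <| (hK _).trans <|
      mul_le_mul_of_nonneg_left (Nat.floor_le (by linarith)) hK0
  have h2 := Real.log_nonneg hu
  have h3 := Real.log_le_self (by linarith : (0 : ℝ) ≤ u)
  have h4 : |b| ≤ |b| * u := le_mul_of_one_le_right (abs_nonneg b) hu
  obtain ⟨h5, h6⟩ := abs_le.1 h1
  obtain ⟨h7, h8⟩ := abs_le.1 h4
  unfold epsErr
  rw [abs_le]
  have := le_abs_self b
  have := neg_abs_le b
  constructor <;> linarith

theorem intervalIntegrable_epsErr_sub {K : ℝ} (hK0 : 0 ≤ K)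
    (hK : ∀ N : ℕ, ∑ h ∈ Finset.Icc 1 N, |singularSeries h| ≤ K * N) (b : ℝ) {y : ℝ} (hy : 1 ≤ y) :
    IntervalIntegrable (fun u => epsErr u - b) volume 1 y := by
  rw [intervalIntegrable_iff_integrableOn_Icc_of_le hy]
  refine IntegrableOn.of_bound measure_Icc_lt_top
    (measurable_epsErr.sub_const b).aestronglyMeasurable ((K + 2 + |b|) * y) ?_
  filter_upwards [ae_restrict_mem measurableSet_Icc] with u hu
  exact (abs_epsErr_sub_le hK0 hK b hu.1).trans
    (mul_le_mul_of_nonneg_left hu.2 (by positivity))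

theorem abs_fErr_le {K : ℝ} (hK0 : 0 ≤ K)
    (hK : ∀ N : ℕ, ∑ h ∈ Finset.Icc 1 N, |singularSeries h| ≤ K * N) {y : ℝ} (hy : 1 ≤ y) :
    |fErr y| ≤ (K + 2 + |Bconst / 2|) * y ^ 2 := by
  have hD : 0 ≤ K + 2 + |Bconst / 2| := by positivity
  have h := intervalIntegral.norm_integral_le_of_norm_le_const (a := 1) (b := y)
    (f := fun u => epsErr u - Bconst / 2) (C := (K + 2 + |Bconst / 2|) * y) fun u hu => by
      rw [Set.uIoc_of_le hy] at hu
      exact (abs_epsErr_sub_le hK0 hK _ hu.1.le).trans (mul_le_mul_of_nonneg_left hu.2 hD)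
  rw [abs_of_nonneg (by linarith : (0 : ℝ) ≤ y - 1)] at h
  refine h.trans ?_
  rw [pow_two, ← mul_assoc]
  exact mul_le_mul_of_nonneg_left (by linarith) (by positivity)

theorem continuousOn_fErr {K : ℝ} (hK0 : 0 ≤ K)
    (hK : ∀ N : ℕ, ∑ h ∈ Finset.Icc 1 N, |singularSeries h| ≤ K * N) :
    ContinuousOn fErr (Set.Ici 1) := by
  intro y hy
  have hy1 : (1 : ℝ) ≤ y + 1 := by linarith [Set.mem_Ici.1 hy]
  have h := intervalIntegral.continuousOn_primitive_interval
    ((intervalIntegrable_iff' (μ := volume)).1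
      (intervalIntegrable_epsErr_sub hK0 hK (Bconst / 2) hy1))
  rw [Set.uIcc_of_le hy1] at h
  refine (h y ⟨hy, by linarith⟩).mono_of_mem_nhdsWithin ?_
  rw [← Set.Ici_inter_Iic]
  exact Filter.inter_mem self_mem_nhdsWithin
    (mem_nhdsWithin_of_mem_nhds (Iic_mem_nhds (by linarith)))

theorem integrableOn_fErr_div {K : ℝ} (hK0 : 0 ≤ K)
    (hK : ∀ N : ℕ, ∑ h ∈ Finset.Icc 1 N, |singularSeries h| ≤ K * N) :
    IntegrableOn (fun u => fErr u / u ^ 4) (Set.Ioi 1) := by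
  have hbase : IntegrableOn (fun u : ℝ => (K + 2 + |Bconst / 2|) * u ^ (-2 : ℝ)) (Set.Ioi 1) :=
    (integrableOn_Ioi_rpow_of_lt (by norm_num) one_pos).const_mul _
  refine Integrable.mono' hbase ?_ ?_
  · refine ContinuousOn.aestronglyMeasurable (ContinuousOn.div
      ((continuousOn_fErr hK0 hK).mono Set.Ioi_subset_Ici_self) (by fun_prop) fun u hu => ?_)
      measurableSet_Ioi
    have : (1 : ℝ) < u := hu
    positivity
  · filter_upwards [ae_restrict_mem measurableSet_Ioi] with u hu
    have hu1 : (1 : ℝ) < u := hu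
    have hu0 : 0 < u := by linarith
    rw [Real.norm_eq_abs, abs_div, abs_of_pos (by positivity : 0 < u ^ 4),
      Real.rpow_neg hu0.le, Real.rpow_two, div_le_iff₀ (by positivity)]
    refine (abs_fErr_le hK0 hK hu1.le).trans (le_of_eq ?_)
    field_simp

/-- Integration by parts: the weighted integral of the partial sums of `𝔖` in terms of `f`. -/
theorem integral_sum_singularSeries_div {K : ℝ} (hK0 : 0 ≤ K)
    (hK : ∀ N : ℕ, ∑ h ∈ Finset.Icc 1 N, |singularSeries h| ≤ K * N) {y : ℝ} (hy : 1 ≤ y) :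
    ∫ u in (1 : ℝ)..y, (∑ h ∈ Finset.Icc 1 ⌊u⌋₊, singularSeries h) / u ^ 3 =
      (fErr y / y ^ 3 - 1 / y + Real.log y / (4 * y ^ 2) + (1 / 8 - Bconst / 4) / y ^ 2) +
        (7 / 8 + Bconst / 4) + 3 * ∫ u in (1 : ℝ)..y, fErr u / u ^ 4 := by
  set F : ℝ → ℝ := fun y =>
    fErr y / y ^ 3 - 1 / y + Real.log y / (4 * y ^ 2) + (1 / 8 - Bconst / 4) / y ^ 2 with hF
  set S : ℝ → ℝ := fun u => ∑ h ∈ Finset.Icc 1 ⌊u⌋₊, singularSeries h with hS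
  have hne (u : ℝ) (hu : u ∈ Set.Icc 1 y) : u ≠ 0 := by linarith [hu.1]
  have hfc : ContinuousOn fErr (Set.Icc 1 y) :=
    (continuousOn_fErr hK0 hK).mono Set.Icc_subset_Ici_self
  have hfi : IntervalIntegrable (fun u => fErr u / u ^ 4) volume 1 y := by
    refine ContinuousOn.intervalIntegrable_of_Icc hy (hfc.div (by fun_prop) fun u hu => ?_)
    exact pow_ne_zero _ (hne u hu)
  have hSi : IntervalIntegrable (fun u => S u / u ^ 3) volume 1 y := by
    rw [intervalIntegrable_iff_integrableOn_Icc_of_le hy]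
    have h := integrableOn_mul_sum_Icc (m := 1) singularSeries zero_le_one (b := y)
      (g := fun u : ℝ => (u ^ 3)⁻¹)
      (ContinuousOn.integrableOn_Icc (ContinuousOn.inv₀ (by fun_prop)
        fun u hu => pow_ne_zero _ (hne u hu)))
    simpa only [hS, div_eq_inv_mul] using h
  have hFc : ContinuousOn F (Set.Icc 1 y) := by
    have h1 : ContinuousOn Real.log (Set.Icc 1 y) :=
      Real.continuousOn_log.mono fun u hu => hne u hu
    refine (((hfc.div (by fun_prop) ?_).sub (continuousOn_const.div continuousOn_id ?_)).add
      (h1.div (by fun_prop) ?_)).add (continuousOn_const.div (by fun_prop) ?_)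
    all_goals
      intro u hu
      have := hne u hu
      simpa using this
  have hderiv : ∀ x ∈ Set.Ioo 1 y,
      HasDerivWithinAt F (S x / x ^ 3 - 3 * (fErr x / x ^ 4)) (Set.Ioi x) x := by
    intro x hx
    have hx0 : x ≠ 0 := by linarith [hx.1]
    have h1 : HasDerivWithinAt fErr (epsErr x - Bconst / 2) (Set.Ioi x) x :=
      (intervalIntegral.integral_hasDerivWithinAt_right (s := Set.Ici x) (t := Set.Ioi x)
        (intervalIntegrable_epsErr_sub hK0 hK _ hx.1.le)
        (measurable_epsErr.sub_const _).stronglyMeasurable.stronglyMeasurableAtFilter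
        ((continuousWithinAt_epsErr (by linarith [hx.1])).sub continuousWithinAt_const)).mono
        Set.Ioi_subset_Ici_self
    have h2 : HasDerivWithinAt Real.log x⁻¹ (Set.Ioi x) x :=
      (Real.hasDerivAt_log hx0).hasDerivWithinAt
    have hpow (n : ℕ) : HasDerivWithinAt (fun u : ℝ => u ^ n) (n * x ^ (n - 1)) (Set.Ioi x) x :=
      (hasDerivAt_pow n x).hasDerivWithinAt
    have h3 := (((h1.div (hpow 3) (pow_ne_zero _ hx0)).sub
      ((hasDerivWithinAt_const x (Set.Ioi x) (1 : ℝ)).div (hasDerivWithinAt_id x _) hx0)).add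
      (h2.div ((hpow 2).const_mul 4) (by positivity))).add
      ((hasDerivWithinAt_const x (Set.Ioi x) (1 / 8 - Bconst / 4)).div (hpow 2)
        (pow_ne_zero _ hx0))
    refine h3.congr_deriv ?_
    have h4 : epsErr x = S x - x + Real.log x / 2 := rfl
    rw [h4]
    simp only [id]
    field_simp
    push_cast
    ring
  have hmain := intervalIntegral.integral_eq_sub_of_hasDeriv_right_of_le hy hFc hderiv
    (hSi.sub (hfi.const_mul 3))
  rw [intervalIntegral.integral_sub hSi (hfi.const_mul 3),
    intervalIntegral.integral_const_mul] at hmain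
  have hF1 : F 1 = -(7 / 8 + Bconst / 4) := by
    simp only [hF, fErr, intervalIntegral.integral_same, Real.log_one]
    ring
  rw [hF1] at hmain
  linarith

open Filter Topology in
/-- The partial sums of `𝔖(h) / h²` converge to the constant expressed through `f`. -/
theorem tendsto_sum_singularSeries_div_sq {K : ℝ} (hK0 : 0 ≤ K)
    (hK : ∀ N : ℕ, ∑ h ∈ Finset.Icc 1 N, |singularSeries h| ≤ K * N) :
    Tendsto (fun N : ℕ => ∑ h ∈ Finset.Icc 1 N, singularSeries h / (h : ℝ) ^ 2) atTop
      (𝓝 (7 / 4 + Bconst / 2 + 6 * ∫ u in Set.Ioi (1 : ℝ), fErr u / u ^ 4)) := by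
  have hinv : Tendsto (fun N : ℕ => (1 : ℝ) / N) atTop (𝓝 0) := tendsto_one_div_atTop_nhds_zero_nat
  have hinv2 : Tendsto (fun N : ℕ => (1 : ℝ) / (N : ℝ) ^ 2) atTop (𝓝 0) := by
    simpa using hinv.pow 2
  have hS : Tendsto (fun N : ℕ => (∑ h ∈ Finset.Icc 1 N, singularSeries h) / (N : ℝ) ^ 2) atTop
      (𝓝 0) := by
    refine squeeze_zero_norm' (a := fun N : ℕ => K * (1 / (N : ℝ))) ?_
      (by simpa using hinv.const_mul K)
    filter_upwards [eventually_ge_atTop 1] with N hN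
    have hN0 : (0 : ℝ) < N := by exact_mod_cast hN
    rw [norm_div, Real.norm_eq_abs, Real.norm_eq_abs, abs_of_pos (by positivity : (0 : ℝ) < N ^ 2),
      div_le_iff₀ (by positivity)]
    refine ((Finset.abs_sum_le_sum_abs _ _).trans (hK N)).trans (le_of_eq ?_)
    field_simp
  have hf : Tendsto (fun N : ℕ => fErr N / (N : ℝ) ^ 3) atTop (𝓝 0) := by
    refine squeeze_zero_norm' (a := fun N : ℕ => (K + 2 + |Bconst / 2|) * (1 / (N : ℝ))) ?_
      (by simpa using hinv.const_mul (K + 2 + |Bconst / 2|))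
    filter_upwards [eventually_ge_atTop 1] with N hN
    have hN0 : (0 : ℝ) < N := by exact_mod_cast hN
    rw [norm_div, Real.norm_eq_abs, Real.norm_eq_abs, abs_of_pos (by positivity : (0 : ℝ) < N ^ 3),
      div_le_iff₀ (by positivity)]
    refine (abs_fErr_le hK0 hK (by exact_mod_cast hN)).trans (le_of_eq ?_)
    field_simp
  have hlog : Tendsto (fun N : ℕ => Real.log N / (4 * (N : ℝ) ^ 2)) atTop (𝓝 0) := by
    refine squeeze_zero_norm' (a := fun N : ℕ => 1 / (N : ℝ)) ?_ hinv
    filter_upwards [eventually_ge_atTop 1] with N hN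
    have hN1 : (1 : ℝ) ≤ N := by exact_mod_cast hN
    have hl := Real.log_le_self (by linarith : (0 : ℝ) ≤ N)
    rw [Real.norm_of_nonneg (div_nonneg (Real.log_nonneg hN1) (by positivity)),
      div_le_div_iff₀ (by positivity) (by positivity)]
    nlinarith
  have hI : Tendsto (fun N : ℕ => ∫ u in (1 : ℝ)..N, fErr u / u ^ 4) atTop
      (𝓝 (∫ u in Set.Ioi (1 : ℝ), fErr u / u ^ 4)) :=
    intervalIntegral_tendsto_integral_Ioi 1 (integrableOn_fErr_div hK0 hK)
      tendsto_natCast_atTop_atTop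
  have hlim := hS.add (((((hf.sub hinv).add hlog).add
    (hinv2.const_mul (1 / 8 - Bconst / 4))).add_const (7 / 8 + Bconst / 4)).add
      (hI.const_mul 3) |>.const_mul 2)
  refine (hlim.congr' ?_).trans_eq ?_
  · filter_upwards [eventually_ge_atTop 1] with N hN
    have hN1 : (1 : ℝ) ≤ N := by exact_mod_cast hN
    rw [sum_Icc_one_div_sq_eq, ← intervalIntegral.integral_of_le hN1,
      integral_sum_singularSeries_div hK0 hK hN1, mul_one_div]
  · congr 1
    ring

/-- Lemma 7.3: `Σ_{h ≤ H} 𝔖(h)/h² = 7/4 + B/2 + 6 ∫_1^∞ f(u)/u⁴ du + O(1/H)`, and the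
full series satisfies `Σ_{h=1}^∞ 𝔖(h)/h² = 7/4 + B/2 + 6 ∫_1^∞ f(u)/u⁴ du`. -/
theorem singularSeries_over_sq_sum :
    (∃ C : ℝ, 0 < C ∧ ∀ H : ℕ, 1 ≤ H →
      |(∑ h ∈ Finset.Icc 1 H, singularSeries h / (h : ℝ) ^ 2) -
        (7 / 4 + Bconst / 2 + 6 * ∫ u in Set.Ioi (1 : ℝ), fErr u / u ^ 4)| ≤ C / H) ∧
    (∑' h : ℕ, singularSeries h / (h : ℝ) ^ 2) =
      7 / 4 + Bconst / 2 + 6 * ∫ u in Set.Ioi (1 : ℝ), fErr u / u ^ 4 := by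
  obtain ⟨K, hK0, hK⟩ := exists_sum_abs_singularSeries_le
  have hlim := tendsto_sum_singularSeries_div_sq hK0 hK
  set L := 7 / 4 + Bconst / 2 + 6 * ∫ u in Set.Ioi (1 : ℝ), fErr u / u ^ 4
  have htail {H M : ℕ} (hH : 1 ≤ H) (hM : H ≤ M) :
      ∑ h ∈ Finset.Ioc H M, |singularSeries h / (h : ℝ) ^ 2| ≤ 2 * K / H := by
    simpa [abs_div] using
      sum_Ioc_div_sq_le (fun n => abs_nonneg (singularSeries n)) hK0 hK hH hM
  refine ⟨⟨2 * K + 1, by linarith, fun H hH => ?_⟩, ?_⟩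
  · have hH0 : (0 : ℝ) < H := by exact_mod_cast hH
    have hle : |(∑ h ∈ Finset.Icc 1 H, singularSeries h / (h : ℝ) ^ 2) - L| ≤ 2 * K / H := by
      refine le_of_tendsto (hlim.const_sub _).abs ?_
      filter_upwards [Filter.eventually_ge_atTop H] with M hM
      rw [abs_sub_comm]
      have hsplit : (∑ h ∈ Finset.Icc 1 M, singularSeries h / (h : ℝ) ^ 2) -
          ∑ h ∈ Finset.Icc 1 H, singularSeries h / (h : ℝ) ^ 2 =
          ∑ h ∈ Finset.Ioc H M, singularSeries h / (h : ℝ) ^ 2 := by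
        have := Finset.sum_Ioc_consecutive (fun h : ℕ => singularSeries h / (h : ℝ) ^ 2)
          H.zero_le hM
        rw [sub_eq_iff_eq_add', ← zero_add 1, Finset.Icc_add_one_left_eq_Ioc,
          Finset.Icc_add_one_left_eq_Ioc, this]
      rw [hsplit]
      exact (Finset.abs_sum_le_sum_abs _ _).trans (htail hH hM)
    exact hle.trans (by gcongr; linarith)
  · have hrange (g : ℕ → ℝ) (hg : g 0 = 0) (N : ℕ) :
        ∑ h ∈ Finset.range (N + 1), g h = ∑ h ∈ Finset.Icc 1 N, g h := by
      rw [Finset.sum_range_succ', hg, add_zero, Finset.range_eq_Ico, Finset.sum_Ico_add' g 0 N 1]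
      rfl
    have hsummable : Summable fun h : ℕ => singularSeries h / (h : ℝ) ^ 2 := by
      refine Summable.of_abs (summable_of_sum_range_le (c := |singularSeries 1| + 2 * K)
        (fun _ => abs_nonneg _) fun n => ?_)
      refine (Finset.sum_le_sum_of_subset_of_nonneg
        (Finset.range_mono (show n ≤ n + 1 + 1 by omega)) fun _ _ _ => abs_nonneg _).trans ?_
      rw [hrange _ (by simp), Finset.Icc_eq_cons_Ioc (by omega), Finset.sum_cons]
      have := htail (le_refl 1) (show 1 ≤ n + 1 by omega)
      simpa using this
    refine tendsto_nhds_unique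
      ((Filter.tendsto_add_atTop_iff_nat 1).2 hsummable.hasSum.tendsto_sum_nat) ?_
    exact hlim.congr fun N => (hrange _ (by simp) N).symm
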